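/- arXiv:1512.04047 — 2 statements merged into one kernel-verified Lean document; each statement's English description precedes it below -/
import Mathlib

section
/- Let G = (V,E) be a graph, let t ≥ 1, and let 𝓗 be a vertex-disjoint packing of induced subgraphs of G with 1 ≤ τ(H) ≤ t for every H ∈ 𝓗, such that for no H = (W,F) ∈ 𝓗 does there exist a set T ⊆ F of exactly τ(H) edges with the property that every triangle of G containing an edge of H contains an edge of T. If G has a triangle-free deletion set of size at most k, then k ≤ (2t+1)·(k − h(𝓗)), where h(𝓗) := Σ_{H∈𝓗} τ(H). -/
open SimpleGraph

/-- `τ` of the subgraph of `G` induced by `W`: the minimum size of a set `T` of edges of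
`G` lying inside `W` whose deletion makes the induced subgraph on `W` triangle-free. -/
noncomputable def tauTriOn {V : Type*} [Fintype V] [DecidableEq V]
    (G : SimpleGraph V) (W : Finset V) : ℕ :=
  sInf {n | ∃ T : Finset (Sym2 V), ↑T ⊆ G.edgeSet ∧ (∀ e ∈ T, ∀ v ∈ e, v ∈ W) ∧
    T.card = n ∧ ((G.deleteEdges ↑T).induce (W : Set V)).CliqueFree 3}

/-- The edges of a triangle-free deletion set lying inside `W` delete all triangles of the
subgraph induced by `W`. -/
theorem tauTriOn_le_card_filter {V : Type*} [Fintype V] [DecidableEq V]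
    (G : SimpleGraph V) (W : Finset V) (S : Finset (Sym2 V)) (hS : ↑S ⊆ G.edgeSet)
    (hfree : (G.deleteEdges ↑S).CliqueFree 3) :
    tauTriOn G W ≤ (S.filter fun e => e.toFinset ⊆ W).card := by
  refine Nat.sInf_le ⟨_, fun e he => hS (Finset.mem_filter.1 he).1, ?_, rfl, ?_⟩
  · intro e he v hv
    exact (Finset.mem_filter.1 he).2 (Sym2.mem_toFinset.2 hv)
  · intro s hs
    obtain ⟨a, b, c, hab, hac, hbc, -⟩ := is3Clique_iff.1 hs
    refine hfree {a.1, b.1, c.1} (is3Clique_triple_iff.2 ⟨?_, ?_, ?_⟩)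
    all_goals
      simp only [comap_adj, deleteEdges_adj, Function.Embedding.subtype_apply,
        Finset.mem_coe, Finset.mem_filter, not_and] at hab hac hbc ⊢
    · refine ⟨hab.1, fun h => hab.2 h fun v hv => ?_⟩
      rcases Sym2.mem_iff.1 (Sym2.mem_toFinset.1 hv) with rfl | rfl
      exacts [a.2, b.2]
    · refine ⟨hac.1, fun h => hac.2 h fun v hv => ?_⟩
      rcases Sym2.mem_iff.1 (Sym2.mem_toFinset.1 hv) with rfl | rfl
      exacts [a.2, c.2]
    · refine ⟨hbc.1, fun h => hbc.2 h fun v hv => ?_⟩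
      rcases Sym2.mem_iff.1 (Sym2.mem_toFinset.1 hv) with rfl | rfl
      exacts [b.2, c.2]

/-- A triangle-free deletion set contains an edge of every triangle. -/
theorem mem_or_mem_or_mem_of_cliqueFree_deleteEdges {V : Type*}
    {G : SimpleGraph V} {S : Set (Sym2 V)} (hfree : (G.deleteEdges S).CliqueFree 3)
    {a b c : V} (hab : G.Adj a b) (hac : G.Adj a c) (hbc : G.Adj b c) :
    s(a, b) ∈ S ∨ s(a, c) ∈ S ∨ s(b, c) ∈ S := by
  classical
  by_contra! h
  exact hfree {a, b, c} (is3Clique_triple_iff.2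
    ⟨deleteEdges_adj.2 ⟨hab, h.1⟩, deleteEdges_adj.2 ⟨hac, h.2.1⟩,
      deleteEdges_adj.2 ⟨hbc, h.2.2⟩⟩)

/-- If no `tauTriOn G W` edges inside `W` meet all triangles sharing an edge with `W`, then a
triangle-free deletion set has more than `2 * tauTriOn G W` edge endpoints in `W`. -/
theorem two_mul_tauTriOn_lt_sum_card_inter {V : Type*} [Fintype V] [DecidableEq V]
    (G : SimpleGraph V) (W : Finset V) (S : Finset (Sym2 V)) (hS : ↑S ⊆ G.edgeSet)
    (hfree : (G.deleteEdges ↑S).CliqueFree 3)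
    (hno : ¬ ∃ T : Finset (Sym2 V), ↑T ⊆ G.edgeSet ∧
      (∀ e ∈ T, ∀ v ∈ e, v ∈ W) ∧ T.card = tauTriOn G W ∧
      (∀ a b c : V, G.Adj a b → G.Adj a c → G.Adj b c →
        ((a ∈ W ∧ b ∈ W) ∨ (a ∈ W ∧ c ∈ W) ∨ (b ∈ W ∧ c ∈ W)) →
        (s(a, b) ∈ T ∨ s(a, c) ∈ T ∨ s(b, c) ∈ T))) :
    2 * tauTriOn G W < ∑ e ∈ S, (e.toFinset ∩ W).card := by
  set I := S.filter fun e => e.toFinset ⊆ W with hI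
  have hle : tauTriOn G W ≤ I.card := tauTriOn_le_card_filter G W S hS hfree
  have hsumI : ∑ e ∈ I, (e.toFinset ∩ W).card = 2 * I.card := by
    rw [Finset.sum_const_nat (m := 2), mul_comm]
    intro e he
    obtain ⟨heS, heW⟩ := Finset.mem_filter.1 he
    rw [Finset.inter_eq_left.2 heW,
      Sym2.card_toFinset_of_not_isDiag e (G.not_isDiag_of_mem_edgeSet (hS heS))]
  have hsplit := Finset.sum_filter_add_sum_filter_not S (fun e => e.toFinset ⊆ W)
    fun e => (e.toFinset ∩ W).card
  rw [← hI, hsumI] at hsplit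
  rcases hle.lt_or_eq with hlt | heq
  · lia
  suffices ∃ e ∈ S, ¬ e.toFinset ⊆ W ∧ ∃ v ∈ e, v ∈ W by
    obtain ⟨e, heS, heW, v, hve, hvW⟩ := this
    have hpos : 0 < (e.toFinset ∩ W).card :=
      Finset.card_pos.2 ⟨v, Finset.mem_inter.2 ⟨Sym2.mem_toFinset.2 hve, hvW⟩⟩
    have := Finset.single_le_sum (f := fun e : Sym2 V => (e.toFinset ∩ W).card)
      (fun _ _ => Nat.zero_le _) ((Finset.mem_filter (p := fun e : Sym2 V => ¬ e.toFinset ⊆ W)).2 ⟨heS, heW⟩)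
    lia
  by_contra! hcross
  refine hno ⟨I, fun e he => hS (Finset.mem_filter.1 he).1,
    fun e he v hv => (Finset.mem_filter.1 he).2 (Sym2.mem_toFinset.2 hv), heq.symm, ?_⟩
  intro a b c hab hac hbc hW
  have hmem : ∀ x y : V, s(x, y) ∈ S → x ∈ W ∨ y ∈ W → s(x, y) ∈ I := by
    intro x y hxy hor
    refine Finset.mem_filter.2 ⟨hxy, ?_⟩
    by_contra hsub
    have := hcross _ hxy hsub
    rcases hor with h | h
    · exact this x (Sym2.mem_mk_left x y) h
    · exact this y (Sym2.mem_mk_right x y) h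
  rcases mem_or_mem_or_mem_of_cliqueFree_deleteEdges hfree hab hac hbc with h | h | h
  · exact Or.inl (hmem _ _ h (by tauto))
  · exact Or.inr (Or.inl (hmem _ _ h (by tauto)))
  · exact Or.inr (Or.inr (hmem _ _ h (by tauto)))

/-- Every edge has at most two endpoints in the members of a family of disjoint sets. -/
theorem sum_sum_card_toFinset_inter_le {V : Type*} [DecidableEq V]
    (𝓗 : Finset (Finset V))
    (hdisj : ∀ W₁ ∈ 𝓗, ∀ W₂ ∈ 𝓗, W₁ ≠ W₂ → Disjoint W₁ W₂) (S : Finset (Sym2 V)) :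
    ∑ W ∈ 𝓗, ∑ e ∈ S, (e.toFinset ∩ W).card ≤ 2 * S.card := by
  rw [Finset.sum_comm, mul_comm, ← smul_eq_mul]
  refine Finset.sum_le_card_nsmul _ _ _ fun e _ => ?_
  rw [← Finset.card_biUnion fun W₁ h₁ W₂ h₂ hne =>
    (hdisj W₁ h₁ W₂ h₂ hne).mono Finset.inter_subset_right Finset.inter_subset_right]
  refine (Finset.card_le_card (Finset.biUnion_subset.2 fun W _ =>
    Finset.inter_subset_left)).trans ?_
  rw [Sym2.card_toFinset]
  split <;> lia

/-- Lemma 4 of the paper. Let `𝓗` be a vertex-disjoint packing of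
induced subgraphs of `G` with `1 ≤ τ(H) ≤ t` for each `H ∈ 𝓗` such that Rule 1 is
inapplicable to every `H ∈ 𝓗` (no set `T` of exactly `τ(H)` edges of `H` destroys all
triangles of `G` containing an edge of `H`). If `G` has a triangle-free deletion set of
size at most `k`, then `k ≤ (2t+1)·(k - h(𝓗))`. -/
theorem stmt3 {V : Type*} [Fintype V] [DecidableEq V]
    (G : SimpleGraph V) (t k : ℕ) (ht : 1 ≤ t)
    (𝓗 : Finset (Finset V))
    (hdisj : ∀ W₁ ∈ 𝓗, ∀ W₂ ∈ 𝓗, W₁ ≠ W₂ → Disjoint W₁ W₂)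
    (htau₁ : ∀ W ∈ 𝓗, 1 ≤ tauTriOn G W) (htau₂ : ∀ W ∈ 𝓗, tauTriOn G W ≤ t)
    (hno : ∀ W ∈ 𝓗, ¬ ∃ T : Finset (Sym2 V), ↑T ⊆ G.edgeSet ∧
      (∀ e ∈ T, ∀ v ∈ e, v ∈ W) ∧ T.card = tauTriOn G W ∧
      (∀ a b c : V, G.Adj a b → G.Adj a c → G.Adj b c →
        ((a ∈ W ∧ b ∈ W) ∨ (a ∈ W ∧ c ∈ W) ∨ (b ∈ W ∧ c ∈ W)) →
        (s(a, b) ∈ T ∨ s(a, c) ∈ T ∨ s(b, c) ∈ T)))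
    (hsol : ∃ S : Finset (Sym2 V), ↑S ⊆ G.edgeSet ∧ S.card ≤ k ∧
      (G.deleteEdges ↑S).CliqueFree 3) :
    (k : ℤ) ≤ (2 * (t : ℤ) + 1) * ((k : ℤ) - ∑ W ∈ 𝓗, (tauTriOn G W : ℤ)) := by
  obtain ⟨S, hS, hSk, hfree⟩ := hsol
  have hlow : ∑ W ∈ 𝓗, (2 * tauTriOn G W + 1) ≤ 2 * S.card :=
    (Finset.sum_le_sum fun W hW => two_mul_tauTriOn_lt_sum_card_inter G W S hS hfree
      (hno W hW)).trans (sum_sum_card_toFinset_inter_le 𝓗 hdisj S)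
  have hup : ∑ W ∈ 𝓗, tauTriOn G W ≤ 𝓗.card * t := Finset.sum_le_card_nsmul _ _ _ htau₂
  rw [Finset.sum_add_distrib, ← Finset.mul_sum, Finset.sum_const, smul_eq_mul, mul_one] at hlow
  rw [← Nat.cast_sum]
  generalize ∑ W ∈ 𝓗, tauTriOn G W = h at *
  have hcard : (𝓗.card : ℤ) ≤ 2 * ((k : ℤ) - h) := by lia
  have hup' : (h : ℤ) ≤ 𝓗.card * t := by exact_mod_cast hup
  nlinarith [mul_le_mul_of_nonneg_right hcard (Int.natCast_nonneg t)]
end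

section
/- Let G = (V,E) be a graph containing an induced path u–v–w on three vertices (so {u,v}, {v,w} ∈ E and {u,w} ∉ E) such that N_G(u) ∖ {u,v,w} = N_G(v) ∖ {u,v,w} = N_G(w) ∖ {u,v,w}. Then G has a minimum-size cluster editing set containing the pair {u,w} (as an insertion); consequently, for every k ≥ 1, G has a cluster editing set of size at most k if and only if the graph obtained from G by inserting the edge {u,w} has a cluster editing set of size at most k − 1. -/
open SimpleGraph

/-- The graph obtained from `G` by applying the edge modification set `S`. -/
def editEdges {V : Type*} (G : SimpleGraph V) (S : Set (Sym2 V)) : SimpleGraph V :=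
  SimpleGraph.fromEdgeSet (symmDiff G.edgeSet S)

/-- A cluster graph: a disjoint union of cliques, equivalently a `P₃`-free graph. -/
def IsClusterGraph {V : Type*} (G : SimpleGraph V) : Prop :=
  ∀ u v w : V, G.Adj u v → G.Adj v w → u ≠ w → G.Adj u w

/-- `S` is a cluster editing set for `G`. -/
def IsClusterEditingSet {V : Type*} (G : SimpleGraph V) (S : Finset (Sym2 V)) : Prop :=
  (∀ e ∈ S, ¬ e.IsDiag) ∧ IsClusterGraph (editEdges G ↑S)

/-- `τ(G)`: the minimum size of a cluster editing set for `G`. -/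
noncomputable def clusterEditNum {V : Type*} [Fintype V] [DecidableEq V]
    (G : SimpleGraph V) : ℕ :=
  sInf {n | ∃ S : Finset (Sym2 V), IsClusterEditingSet G S ∧ S.card = n}

theorem editEdges_adj {V : Type*} (G : SimpleGraph V) (S : Set (Sym2 V)) (a b : V) :
    (editEdges G S).Adj a b ↔ (G.Adj a b ↔ s(a, b) ∉ S) ∧ a ≠ b := by
  simp only [editEdges, fromEdgeSet_adj, Set.mem_symmDiff, mem_edgeSet]
  tauto

theorem editEdges_symmDiff_edgeSet {V : Type*} (G H : SimpleGraph V) :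
    editEdges G (symmDiff G.edgeSet H.edgeSet) = H := by
  simp [editEdges, symmDiff_symmDiff_cancel_left]

theorem editEdges_editEdges {V : Type*} (G : SimpleGraph V) (S T : Set (Sym2 V)) :
    editEdges (editEdges G S) T = editEdges G (symmDiff S T) := by
  ext a b
  simp only [editEdges_adj, Set.mem_symmDiff]
  tauto

theorem exists_isClusterEditingSet_card_eq {V : Type*} [Fintype V] [DecidableEq V]
    (G : SimpleGraph V) :
    ∃ S : Finset (Sym2 V), IsClusterEditingSet G S ∧ S.card = clusterEditNum G := by
  classical
  refine Nat.sInf_mem (s := {n | ∃ S : Finset (Sym2 V), IsClusterEditingSet G S ∧ S.card = n})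
    ⟨_, G.edgeFinset, ⟨fun e he ↦ G.not_isDiag_of_mem_edgeFinset he, ?_⟩, rfl⟩
  intro a b c hab
  simp [editEdges] at hab

theorem clusterEditNum_le {V : Type*} [Fintype V] [DecidableEq V] {G : SimpleGraph V}
    {S : Finset (Sym2 V)} (hS : IsClusterEditingSet G S) : clusterEditNum G ≤ S.card :=
  Nat.sInf_le ⟨S, hS, rfl⟩

/-- The graph obtained from `H` by giving every vertex `a` the neighbors of its representative
`φ a` and joining vertices with the same representative. -/
def blowUp {V : Type*} (H : SimpleGraph V) (φ : V → V) : SimpleGraph V where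
  Adj a b := a ≠ b ∧ (φ a = φ b ∨ H.Adj (φ a) (φ b))
  symm := ⟨fun _ _ h ↦ ⟨h.1.symm, h.2.imp Eq.symm fun h ↦ h.symm⟩⟩
  loopless := ⟨fun _ h ↦ h.1 rfl⟩

theorem IsClusterGraph.blowUp {V : Type*} {H : SimpleGraph V} (hH : IsClusterGraph H)
    (φ : V → V) : IsClusterGraph (blowUp H φ) := by
  rintro a b c ⟨_, hab⟩ ⟨_, hbc⟩ hac
  refine ⟨hac, ?_⟩
  by_cases h : φ a = φ c
  · exact .inl h
  · rcases hab with hab | hab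
    · rw [hab] at h ⊢
      exact .inr (hbc.resolve_left h)
    · rcases hbc with hbc | hbc
      · exact .inr (hbc ▸ hab)
      · exact .inr (hH _ _ _ hab hbc h)

/-- If the vertices of `M` have the same neighbors outside `M`, and exactly one pair inside `M`
is not adjacent, then a cluster editing set touching a pair inside `M` can be replaced by one
that is no larger and inserts the missing pair. -/
theorem IsClusterEditingSet.exists_card_le_mem {V : Type*} [Fintype V] [DecidableEq V]
    {G : SimpleGraph V} {M : Finset V} {u w : V} (hu : u ∈ M) (hw : w ∈ M) (hne : u ≠ w)
    (huw : ¬ G.Adj u w)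
    (hM : ∀ a ∈ M, ∀ b ∈ M, a ≠ b → ¬ G.Adj a b → s(a, b) = s(u, w))
    (hN : ∀ a ∈ M, ∀ b ∈ M, ∀ y ∉ M, G.Adj a y ↔ G.Adj b y)
    {S : Finset (Sym2 V)} (hS : IsClusterEditingSet G S)
    (hI : ∃ e ∈ S, ∀ a ∈ e, a ∈ M) :
    ∃ T : Finset (Sym2 V), IsClusterEditingSet G T ∧ T.card ≤ S.card ∧ s(u, w) ∈ T := by
  classical
  let A : V → Finset V := fun p ↦ {y | y ∉ M ∧ s(p, y) ∈ S}
  obtain ⟨x, hx, hmin⟩ := M.exists_min_image (fun p ↦ (A p).card) ⟨u, hu⟩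
  let φ : V → V := fun a ↦ if a ∈ M then x else a
  have φ_in : ∀ a ∈ M, φ a = x := fun a ha ↦ if_pos ha
  have φ_out : ∀ a ∉ M, φ a = a := fun a ha ↦ if_neg ha
  let H := editEdges G (S : Set (Sym2 V))
  let O : Finset (Sym2 V) := {e ∈ S | ∀ a ∈ e, a ∉ M}
  let T : Finset (Sym2 V) := (symmDiff G.edgeSet (blowUp H φ).edgeSet).toFinset
  have mem_T : ∀ a b, s(a, b) ∈ T ↔ ¬ (G.Adj a b ↔ (blowUp H φ).Adj a b) := by
    intro a b
    simp only [T, Set.mem_toFinset, Set.mem_symmDiff, mem_edgeSet]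
    tauto
  have cross : ∀ a ∈ M, ∀ b ∉ M, s(a, b) ∈ T → s(x, b) ∈ S := by
    intro a ha b hb hT
    have hxb : x ≠ b := fun h ↦ hb (h ▸ hx)
    have hab : a ≠ b := fun h ↦ hb (h ▸ ha)
    rw [mem_T, hN a ha x hx b hb] at hT
    simp only [blowUp, φ_in a ha, φ_out b hb, H, editEdges_adj, Finset.mem_coe] at hT
    tauto
  refine ⟨T, ⟨?_, ?_⟩, ?_, ?_⟩
  · rintro ⟨a, b⟩ he hd
    obtain rfl : a = b := hd
    exact (mem_T a a).1 he (by simp)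
  · rw [Set.coe_toFinset, editEdges_symmDiff_edgeSet]
    exact hS.2.blowUp φ
  · have hsub : T ⊆ O ∪ (M ×ˢ A x).image (fun p ↦ s(p.1, p.2)) ∪ {s(u, w)} := by
      rintro ⟨a, b⟩ he
      change s(a, b) ∈ T at he
      change s(a, b) ∈ _
      rw [Finset.mem_union, Finset.mem_union, Finset.mem_image, Finset.mem_singleton]
      by_cases ha : a ∈ M <;> by_cases hb : b ∈ M
      · refine .inr ?_
        rw [mem_T] at he
        have hab : a ≠ b := by
          rintro rfl
          exact he (by simp)
        have hadj : (blowUp H φ).Adj a b := ⟨hab, .inl (by rw [φ_in a ha, φ_in b hb])⟩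
        exact hM a ha b hb hab (by tauto)
      · exact .inl (.inr ⟨(a, b), by simp [A, ha, hb, cross a ha b hb he], rfl⟩)
      · rw [Sym2.eq_swap] at he
        exact .inl (.inr ⟨(b, a), by simp [A, ha, hb, cross b hb a ha he], Sym2.eq_swap⟩)
      · refine .inl (.inl ?_)
        rw [mem_T] at he
        simp only [blowUp, φ_out a ha, φ_out b hb, H, editEdges_adj, Finset.mem_coe] at he
        have hadj : G.Adj a b → a ≠ b := fun h ↦ h.ne
        simp only [O, Finset.mem_filter, Sym2.mem_iff, forall_eq_or_imp, forall_eq]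
        tauto
    obtain ⟨i, hiS, hiM⟩ := hI
    let B : Finset (Sym2 V) := (M.sigma A).image (fun p ↦ s(p.1, p.2))
    have mem_B : ∀ e ∈ B, e ∈ S ∧ ∃ a ∈ M, ∃ b ∉ M, e = s(a, b) := by
      intro e he
      obtain ⟨⟨a, b⟩, hp, rfl⟩ := Finset.mem_image.1 he
      simp only [A, Finset.mem_sigma, Finset.mem_filter, Finset.mem_univ, true_and] at hp
      exact ⟨hp.2.2, a, hp.1, b, hp.2.1, rfl⟩
    have hBcard : B.card = ∑ p ∈ M, (A p).card := by
      rw [Finset.card_image_of_injOn, Finset.card_sigma]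
      rintro ⟨a, b⟩ hp ⟨c, d⟩ hq h
      simp only [A, Finset.coe_sigma, Set.mem_sigma_iff, Finset.mem_coe, Finset.mem_filter,
        Finset.mem_univ, true_and] at hp hq
      rcases Sym2.eq_iff.1 h with ⟨rfl, rfl⟩ | ⟨rfl, rfl⟩
      · rfl
      · exact absurd hp.1 hq.2.1
    have hOB : Disjoint O B := by
      refine Finset.disjoint_left.2 fun e heO heB ↦ ?_
      obtain ⟨-, a, ha, b, -, rfl⟩ := mem_B e heB
      exact (Finset.mem_filter.1 heO).2 a (Sym2.mem_mk_left a b) ha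
    have hiOB : Disjoint (O ∪ B) {i} := by
      rw [Finset.disjoint_singleton_right, Finset.mem_union]
      rintro (hi | hi)
      · exact (Finset.mem_filter.1 hi).2 _ i.out_fst_mem (hiM _ i.out_fst_mem)
      · obtain ⟨-, a, -, b, hb, rfl⟩ := mem_B i hi
        exact hb (hiM b (Sym2.mem_mk_right a b))
    have hsup : O ∪ B ∪ {i} ⊆ S :=
      Finset.union_subset (Finset.union_subset (Finset.filter_subset _ _)
        fun e he ↦ (mem_B e he).1) (Finset.singleton_subset_iff.2 hiS)
    calc T.card
        ≤ O.card + (M ×ˢ A x).card + 1 := by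
          refine (Finset.card_le_card hsub).trans ((Finset.card_union_le _ _).trans ?_)
          rw [Finset.card_singleton]
          gcongr
          exact (Finset.card_union_le _ _).trans (by gcongr; exact Finset.card_image_le)
      _ ≤ O.card + B.card + 1 := by
          rw [hBcard, Finset.card_product]
          gcongr
          exact Finset.card_nsmul_le_sum M _ _ hmin
      _ = (O ∪ B ∪ {i}).card := by
          rw [Finset.card_union_of_disjoint hiOB, Finset.card_union_of_disjoint hOB,
            Finset.card_singleton]
      _ ≤ S.card := Finset.card_le_card hsup
  · rw [mem_T]
    intro h
    exact huw (h.2 ⟨hne, .inl (by rw [φ_in u hu, φ_in w hw])⟩)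

/-- correctness of Rule 4 for Cluster Editing. If `G` contains an
induced path `u–v–w` such that `u`, `v` and `w` have identical neighborhoods outside
`{u,v,w}`, then `G` has a minimum-size cluster editing set containing the insertion
`{u,w}`; consequently, for every `k ≥ 1`, `G` has a cluster editing set of size at most
`k` iff the graph obtained by inserting the edge `{u,w}` has one of size at most
`k - 1`. -/
theorem stmt11 {V : Type*} [Fintype V] [DecidableEq V]
    (G : SimpleGraph V) (u v w : V)
    (huv : G.Adj u v) (hvw : G.Adj v w) (huw : ¬ G.Adj u w) (hne : u ≠ w)
    (h1 : G.neighborSet u \ {u, v, w} = G.neighborSet v \ {u, v, w})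
    (h2 : G.neighborSet v \ {u, v, w} = G.neighborSet w \ {u, v, w}) :
    (∃ S : Finset (Sym2 V), IsClusterEditingSet G S ∧
      S.card = clusterEditNum G ∧ s(u, w) ∈ S) ∧
    (∀ k : ℕ, 1 ≤ k →
      ((∃ S : Finset (Sym2 V), IsClusterEditingSet G S ∧ S.card ≤ k) ↔
        (∃ S : Finset (Sym2 V),
          IsClusterEditingSet (editEdges G {s(u, w)}) S ∧ S.card ≤ k - 1))) := by
  have hmem : ∃ S : Finset (Sym2 V), IsClusterEditingSet G S ∧
      S.card = clusterEditNum G ∧ s(u, w) ∈ S := by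
    obtain ⟨S, hS, hcard⟩ := exists_isClusterEditingSet_card_eq G
    have hI : ∃ e ∈ S, ∀ a ∈ e, a ∈ ({u, v, w} : Finset V) := by
      by_contra! hI
      have hout : ∀ a ∈ ({u, v, w} : Finset V), ∀ b ∈ ({u, v, w} : Finset V), s(a, b) ∉ S := by
        intro a ha b hb hab
        obtain ⟨c, hc, hcM⟩ := hI _ hab
        rcases Sym2.mem_iff.1 hc with rfl | rfl <;> contradiction
      have := hS.2 u v w (by simp [editEdges_adj, huv, huv.ne, hout])
        (by simp [editEdges_adj, hvw, hvw.ne, hout]) hne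
      simp [editEdges_adj, huw, hout] at this
    have hNu : ∀ y, y ∉ ({u, v, w} : Finset V) → (G.Adj u y ↔ G.Adj v y) := by
      intro y hy
      have := Set.ext_iff.1 h1 y
      simp only [Finset.mem_insert, Finset.mem_singleton] at hy
      simpa [hy] using this
    have hNw : ∀ y, y ∉ ({u, v, w} : Finset V) → (G.Adj v y ↔ G.Adj w y) := by
      intro y hy
      have := Set.ext_iff.1 h2 y
      simp only [Finset.mem_insert, Finset.mem_singleton] at hy
      simpa [hy] using this
    obtain ⟨T, hT, hle, huwT⟩ := hS.exists_card_le_mem (M := {u, v, w}) (u := u) (w := w)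
      (by simp) (by simp) hne huw
      (by
        intro a ha b hb hab hadj
        simp only [Finset.mem_insert, Finset.mem_singleton] at ha hb
        have := huv.symm
        have := hvw.symm
        rcases ha with rfl | rfl | rfl <;> rcases hb with rfl | rfl | rfl <;>
          first | contradiction | rfl | exact Sym2.eq_swap)
      (by
        intro a ha b hb y hy
        have := hNu y hy
        have := hNw y hy
        simp only [Finset.mem_insert, Finset.mem_singleton] at ha hb
        rcases ha with rfl | rfl | rfl <;> rcases hb with rfl | rfl | rfl <;> tauto)
      hI
    exact ⟨T, hT, le_antisymm (hle.trans hcard.le) (clusterEditNum_le hT), huwT⟩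
  refine ⟨hmem, fun k hk ↦ ⟨?_, ?_⟩⟩
  · rintro ⟨S, hS, hSk⟩
    obtain ⟨T, hT, hcard, huwT⟩ := hmem
    refine ⟨T.erase s(u, w), ⟨fun e he ↦ hT.1 e (Finset.mem_of_mem_erase he), ?_⟩, ?_⟩
    · rw [editEdges_editEdges]
      convert hT.2 using 2
      ext e
      by_cases h : e = s(u, w) <;> simp [h, huwT]
    · rw [Finset.card_erase_of_mem huwT, hcard]
      exact Nat.sub_le_sub_right ((clusterEditNum_le hS).trans hSk) 1
  · rintro ⟨S, hS, hSk⟩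
    refine ⟨symmDiff {s(u, w)} S, ⟨fun e he ↦ ?_, ?_⟩, ?_⟩
    · rcases Finset.mem_symmDiff.1 he with h | h
      · rw [Finset.mem_singleton.1 h.1]
        exact hne
      · exact hS.1 e h.1
    · rw [Finset.coe_symmDiff, Finset.coe_singleton, ← editEdges_editEdges]
      exact hS.2
    · have hsub : symmDiff {s(u, w)} S ⊆ {s(u, w)} ∪ S := symmDiff_le_sup
      have := (Finset.card_le_card hsub).trans (Finset.card_union_le _ _)
      rw [Finset.card_singleton] at this
      omega
end
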